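/- Let p be a prime and let A_1, …, A_{2p−1} be nonempty subsets of ℤ/p. Then there exists an injective map π : ℤ/p → {1, …, 2p−1} such that the indexed collection of shifted sets (A_{π(i)} + i)_{i ∈ ℤ/p} is balanced; that is, there exist weights w_i ∈ [0,1] for i ∈ ℤ/p such that for every v ∈ ℤ/p, Σ_{i ∈ ℤ/p : v ∈ A_{π(i)} + i} w_i = 1. -/

import Mathlib

section ConeSign

variable {ι : Type*} [Fintype ι]

lemma sum_separating_signs (a r s : ι → ℝ) (ha : ∀ k, a k ≠ 0) (hr : Function.Injective r)
    (hs : ∀ k, 0 < s k) (has : 0 < ∑ k, a k * s k) (hras : 0 < ∑ k, r k * a k * s k)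
    [∀ k, Decidable (0 < r k ∧ ∀ l, l ≠ k → 0 < a l * (r k - r l))] [Decidable (∀ k, 0 < a k)] :
    (∑ k, if 0 < r k ∧ ∀ l, l ≠ k → 0 < a l * (r k - r l) then (if 0 < a k then 1 else -1) else 0)
      = if ∀ k, 0 < a k then (1 : ℤ) else 0 := by
  classical
  obtain ⟨k₀, -, hk₀⟩ : ∃ k ∈ Finset.univ, 0 < a k * s k := by
    by_contra! h
    exact absurd (Finset.sum_nonpos h) (not_le.2 has)
  have hk₀' : 0 < a k₀ := pos_of_mul_pos_left hk₀ (hs k₀).le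
  obtain ⟨x, hx, hxmax⟩ := Finset.exists_max_image (Finset.univ.filter fun k => 0 < a k) r
    ⟨k₀, by simpa using hk₀'⟩
  simp only [Finset.mem_filter, Finset.mem_univ, true_and] at hx hxmax
  have hxlt : ∀ k, 0 < a k → k ≠ x → r k < r x := fun k hk hkx =>
    lt_of_le_of_ne (hxmax k hk) (hr.ne hkx)
  have hrx : (∀ k, a k < 0 → r x < r k) → 0 < r x := by
    intro h
    have h1 : ∑ k, r k * a k * s k ≤ ∑ k, r x * (a k * s k) := by
      refine Finset.sum_le_sum fun k _ => ?_
      rw [mul_assoc]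
      rcases lt_or_gt_of_ne (ha k) with hk | hk
      · exact mul_le_mul_of_nonpos_right (h k hk).le (mul_neg_of_neg_of_pos hk (hs k)).le
      · exact mul_le_mul_of_nonneg_right (hxmax k hk) (mul_pos hk (hs k)).le
    rw [← Finset.mul_sum] at h1
    exact pos_of_mul_pos_left (hras.trans_le h1) has.le
  by_cases hall : ∀ k, 0 < a k
  · rw [if_pos hall, Finset.sum_eq_single x]
    · rw [if_pos, if_pos hx]
      exact ⟨hrx fun k hk => absurd (hall k) hk.not_gt,
        fun l hl => mul_pos (hall l) (sub_pos.2 (hxlt l (hall l) hl))⟩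
    · intro k _ hk
      rw [if_neg]
      rintro ⟨-, h⟩
      exact absurd (pos_of_mul_pos_right (h x hk.symm) hx.le) (by
        have := hxlt k (hall k) hk
        linarith)
    · simp
  · rw [if_neg hall]
    push Not at hall
    obtain ⟨k₁, hk₁⟩ := hall
    obtain ⟨y, hy, hymin⟩ := Finset.exists_min_image (Finset.univ.filter fun k => a k < 0) r
      ⟨k₁, by simpa using lt_of_le_of_ne hk₁ (ha k₁)⟩
    simp only [Finset.mem_filter, Finset.mem_univ, true_and] at hy hymin
    have hylt : ∀ k, a k < 0 → k ≠ y → r y < r k := fun k hk hky =>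
      lt_of_le_of_ne (hymin k hk) (hr.ne hky.symm)
    have hxy : x ≠ y := by rintro rfl; linarith
    have hzero : ∀ k, k ≠ x → k ≠ y → ¬ (0 < r k ∧ ∀ l, l ≠ k → 0 < a l * (r k - r l)) := by
      rintro k hkx hky ⟨-, h⟩
      have h1 := pos_of_mul_pos_right (h x hkx.symm) hx.le
      have h2 := neg_of_mul_pos_right (h y hky.symm) hy.le
      rcases lt_or_gt_of_ne (ha k) with hk | hk
      · have := hylt k hk hky
        linarith
      · have := hxlt k hk hkx
        linarith
    by_cases h : r x < r y
    · have hpos : 0 < r x := hrx fun k hk => h.trans_le (hymin k hk)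
      rw [Fintype.sum_eq_add x y hxy fun k hk => if_neg (hzero k hk.1 hk.2), if_pos, if_pos hx,
        if_pos, if_neg hy.not_gt]
      · norm_num
      · refine ⟨hpos.trans h, fun l hl => ?_⟩
        rcases lt_or_gt_of_ne (ha l) with hk | hk
        · exact mul_pos_of_neg_of_neg hk (sub_neg.2 (hylt l hk hl))
        · exact mul_pos hk (sub_pos.2 ((hxmax l hk).trans_lt h))
      · refine ⟨hpos, fun l hl => ?_⟩
        rcases lt_or_gt_of_ne (ha l) with hk | hk
        · exact mul_pos_of_neg_of_neg hk (sub_neg.2 (h.trans_le (hymin l hk)))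
        · exact mul_pos hk (sub_pos.2 (hxlt l hk hl))
    · refine Finset.sum_eq_zero fun k _ => if_neg ?_
      by_cases hkx : k = x
      · rintro ⟨-, h'⟩
        have := neg_of_mul_pos_right (h' y (by rw [hkx]; exact hxy.symm)) hy.le
        rw [hkx] at this
        linarith
      by_cases hky : k = y
      · rintro ⟨-, h'⟩
        have := pos_of_mul_pos_right (h' x (by rw [hky]; exact hxy)) hx.le
        rw [hky] at this
        linarith
      exact hzero k hkx hky

variable [DecidableEq ι]

open Classical in
/-- The sign of `det M` if the all-ones vector lies in the open simplicial cone spanned by the rows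
of `M`, and `0` otherwise. -/
noncomputable def coneSign (M : Matrix ι ι ℝ) : ℤ :=
  if ∀ k, 0 < M.det * (M.updateRow k 1).det then (if 0 < M.det then 1 else -1) else 0

lemma exists_cone_coeff (M : Matrix ι ι ℝ) (hD : M.det ≠ 0) (v : ι → ℝ) :
    ∃ a : ι → ℝ, v = ∑ k, a k • M k ∧ ∀ k, (M.updateRow k v).det = a k * M.det := by
  have h : v = ∑ k, ((M.updateRow k v).det / M.det) • M k := by
    have h1 := Matrix.mulVec_cramer M.transpose v
    rw [Matrix.det_transpose] at h1
    ext i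
    have h2 := congrFun h1 i
    simp only [Matrix.mulVec, dotProduct, Matrix.transpose_apply, Pi.smul_apply, smul_eq_mul,
      Matrix.cramer_transpose_apply] at h2
    simp only [Finset.sum_apply, Pi.smul_apply, smul_eq_mul]
    rw [eq_comm, ← mul_right_inj' hD, ← h2, Finset.mul_sum]
    refine Finset.sum_congr rfl fun k _ => ?_
    field_simp
  exact ⟨_, h, fun k => by field_simp⟩

lemma exists_of_coneSign_ne_zero {M : Matrix ι ι ℝ} (h : coneSign M ≠ 0) :
    ∃ a : ι → ℝ, (∀ k, 0 < a k) ∧ ∑ k, a k • M k = 1 := by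
  unfold coneSign at h
  rw [ite_ne_right_iff] at h
  obtain ⟨h, -⟩ := h
  by_cases hD : M.det = 0
  · simp only [hD, zero_mul, lt_irrefl] at h
    have : IsEmpty ι := ⟨h⟩
    exact ⟨0, fun k => isEmptyElim k, Subsingleton.elim _ _⟩
  · obtain ⟨a, h1, h2⟩ := exists_cone_coeff M hD 1
    refine ⟨a, fun k => ?_, h1.symm⟩
    have := h k
    rw [h2] at this
    nlinarith [mul_self_pos.2 hD]

lemma coneSign_submatrix (M : Matrix ι ι ℝ) (e : Equiv.Perm ι) :
    coneSign (M.submatrix e e) = coneSign M := by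
  have h : ∀ k, ((M.submatrix e e).updateRow k 1).det = (M.updateRow (e k) 1).det := by
    intro k
    rw [← Matrix.det_submatrix_equiv_self e (M.updateRow (e k) 1)]
    congr 1
    ext i j
    simp [Matrix.updateRow_apply]
  have h' : (∀ k, 0 < M.det * (M.updateRow (e k) 1).det) ↔
      ∀ k, 0 < M.det * (M.updateRow k 1).det :=
    ⟨fun H k => by simpa using H (e.symm k), fun H k => H _⟩
  unfold coneSign
  simp only [h, Matrix.det_submatrix_equiv_self, h']

lemma coneSign_swap (M : Matrix ι ι ℝ) {a b : ι} (hab : a ≠ b) :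
    coneSign (M.submatrix (Equiv.swap a b) id) = -coneSign M := by
  have h : ∀ k, ((M.submatrix (Equiv.swap a b) id).updateRow k 1).det
      = -(M.updateRow (Equiv.swap a b k) 1).det := by
    intro k
    have := Matrix.det_permute (Equiv.swap a b) (M.updateRow (Equiv.swap a b k) 1)
    rw [Equiv.Perm.sign_swap hab] at this
    simp only [Units.val_neg, Units.val_one, Int.cast_neg, Int.cast_one, neg_mul, one_mul] at this
    rw [← this]
    congr 1
    ext i j
    simp [Matrix.updateRow_apply]
  have h' : (M.submatrix (Equiv.swap a b) id).det = - M.det := by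
    simp [Matrix.det_permute, Equiv.Perm.sign_swap hab]
  unfold coneSign
  simp only [h, h', neg_mul_neg]
  have e : (∀ k, 0 < M.det * (M.updateRow (Equiv.swap a b k) 1).det) ↔
      ∀ k, 0 < M.det * (M.updateRow k 1).det :=
    ⟨fun H k => by simpa using H (Equiv.swap a b k), fun H k => H _⟩
  simp only [e]
  split_ifs with h1 h2 h3 h3
  · linarith
  · rfl
  · rfl
  · have := h1 a
    have : M.det = 0 := by linarith
    simp [this] at h1
    exact (h1 a).elim
  · rfl

/-- If no `card ι - 1` of the rows of `M` and `w` span a space containing the all-ones vector, then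
replacing the rows of `M` by `w` one at a time gives cones whose signs add up to that of `M`. -/
lemma coneSign_eq_sum_updateRow (M : Matrix ι ι ℝ) (w : ι → ℝ) (hD : M.det ≠ 0)
    (h1 : ∀ k, (M.updateRow k 1).det ≠ 0) (hw : ∀ k, (M.updateRow k w).det ≠ 0)
    (hw1 : ∀ k l, ((M.updateRow k w).updateRow l 1).det ≠ 0)
    (hM : ∀ k, 0 < ∑ i, M k i) (hws : 0 < ∑ i, w i) [Nonempty ι] :
    coneSign M = ∑ k, coneSign (M.updateRow k w) := by
  obtain ⟨a, hua, hDa⟩ := exists_cone_coeff M hD 1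
  obtain ⟨b, hwb, hDb⟩ := exists_cone_coeff M hD w
  have ha : ∀ k, a k ≠ 0 := fun k h => h1 k (by rw [hDa, h, zero_mul])
  have hb : ∀ k, b k ≠ 0 := fun k h => hw k (by rw [hDb, h, zero_mul])
  have hE : ∀ k l, l ≠ k → ((M.updateRow k w).updateRow l 1).det
      = (b k * a l - b l * a k) * M.det := by
    intro k l hlk
    have hN : (1 : ι → ℝ) = ∑ i, (if i = k then a k / b k else a i - b i * a k / b k) •
        (M.updateRow k w) i := by
      have hterm : ∀ i j, (if i = k then a k / b k else a i - b i * a k / b k) *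
          (M.updateRow k w) i j = a i * M i j - a k / b k * (b i * M i j) +
            if i = k then a k / b k * w j else 0 := by
        intro i j
        have := hb k
        by_cases hik : i = k
        · subst hik
          simp only [if_true, Matrix.updateRow_self]
          field_simp
          ring
        · simp only [if_neg hik, Matrix.updateRow_ne hik]
          ring
      ext j
      have h1j := congrFun hua j
      have h2j := congrFun hwb j
      simp only [Finset.sum_apply, Pi.smul_apply, smul_eq_mul] at h1j h2j ⊢
      simp only [hterm]
      rw [Finset.sum_add_distrib, Finset.sum_sub_distrib, ← Finset.mul_sum, ← h1j, ← h2j]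
      simp
    rw [hN, Matrix.det_updateRow_sum, hDb, if_neg hlk, smul_eq_mul]
    have := hb k
    field_simp
  have hr : Function.Injective fun k => b k / a k := by
    intro k l hkl
    by_contra hne
    apply hw1 k l
    rw [hE k l (Ne.symm hne)]
    have h := hkl
    have hk := ha k
    have hl := ha l
    simp only at h
    rw [div_eq_div_iff hk hl] at h
    rw [h, sub_self, zero_mul]
  have hsum : ∀ (c v : ι → ℝ), v = ∑ k, c k • M k → ∑ i, v i = ∑ k, c k * ∑ i, M k i := by
    intro c v hv
    rw [hv]
    simp only [Finset.sum_apply, Pi.smul_apply, smul_eq_mul, Finset.mul_sum]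
    exact Finset.sum_comm
  have key := sum_separating_signs a (fun k => b k / a k) (fun k => ∑ i, M k i) ha hr hM
    (by rw [← hsum a _ hua]; simp [Fintype.card_pos])
    (by
      have : ∀ k, b k / a k * a k = b k := fun k => div_mul_cancel₀ _ (ha k)
      simp only [this]
      rwa [← hsum b _ hwb])
  have hDD := mul_self_pos.2 hD
  have hM' : coneSign M = (if 0 < M.det then 1 else -1) *
      (if ∀ k, 0 < a k then 1 else 0) := by
    unfold coneSign
    have : ∀ k, 0 < M.det * (M.updateRow k 1).det ↔ 0 < a k := fun k => by
      rw [hDa, show M.det * (a k * M.det) = a k * (M.det * M.det) by ring]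
      exact mul_pos_iff_of_pos_right hDD
    simp only [this]
    split_ifs <;> rfl
  rw [hM', ← key, Finset.mul_sum]
  refine Finset.sum_congr rfl fun k _ => ?_
  have hcond : (∀ l, 0 < (M.updateRow k w).det * ((M.updateRow k w).updateRow l 1).det) ↔
      (0 < b k / a k ∧ ∀ l, l ≠ k → 0 < a l * (b k / a k - b l / a l)) := by
    have e1 : 0 < (M.updateRow k w).det * ((M.updateRow k w).updateRow k 1).det ↔
        0 < b k / a k := by
      rw [hDb, Matrix.updateRow_idem, hDa,
        show b k * M.det * (a k * M.det) = b k * a k * (M.det * M.det) by ring,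
        mul_pos_iff_of_pos_right hDD, div_eq_mul_inv, mul_pos_iff, mul_pos_iff, inv_pos,
        inv_lt_zero]
    have e2 : 0 < b k / a k → ∀ l, l ≠ k →
        (0 < (M.updateRow k w).det * ((M.updateRow k w).updateRow l 1).det ↔
          0 < a l * (b k / a k - b l / a l)) := by
      intro hk l hl
      have hak := ha k
      have hal := ha l
      rw [hDb, hE k l hl,
        show b k * M.det * ((b k * a l - b l * a k) * M.det)
          = (a l * (b k / a k - b l / a l)) * ((b k / a k) * (a k * a k) * (M.det * M.det)) by
            field_simp]
      exact mul_pos_iff_of_pos_right (mul_pos (mul_pos hk (mul_self_pos.2 hak)) hDD)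
    constructor
    · intro H
      exact ⟨e1.1 (H k), fun l hl => (e2 (e1.1 (H k)) l hl).1 (H l)⟩
    · rintro ⟨H1, H2⟩ l
      by_cases hl : l = k
      · rw [hl]; exact e1.2 H1
      · exact (e2 H1 l hl).2 (H2 l hl)
  unfold coneSign
  simp only [hcond]
  by_cases hV : (0 < b k / a k ∧ ∀ l, l ≠ k → 0 < a l * (b k / a k - b l / a l))
  · simp only [if_pos hV]
    rw [hDb]
    have hba : 0 < b k ↔ 0 < a k := by
      rcases div_pos_iff.1 hV.1 with h | h
      · simp [h.1, h.2]
      · simp [h.1.not_gt, h.2.not_gt]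
    rcases lt_or_gt_of_ne hD with hd | hd <;> rcases lt_or_gt_of_ne (hb k) with hbk | hbk
    · rw [if_pos (mul_pos_of_neg_of_neg hbk hd), if_neg hd.not_gt,
        if_neg (fun h => hbk.not_gt (hba.2 h))]; rfl
    · rw [if_neg (mul_neg_of_pos_of_neg hbk hd).not_gt, if_neg hd.not_gt, if_pos (hba.1 hbk)]; rfl
    · rw [if_neg (mul_neg_of_neg_of_pos hbk hd).not_gt, if_pos hd,
        if_neg (fun h => hbk.not_gt (hba.2 h))]; rfl
    · rw [if_pos (mul_pos hbk hd), if_pos hd, if_pos (hba.1 hbk)]; rfl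
  · simp only [if_neg hV, mul_zero]

end ConeSign

section ShiftedRows

variable {p : ℕ} [Fact p.Prime] {Q : Type*}

/-- The matrix whose `k`-th row is the vector `θ (r k)` cyclically shifted by `s k`. -/
def shiftedRows (θ : Q → ZMod p → ℝ) (r : ZMod p → Q) (s : ZMod p → ZMod p) :
    Matrix (ZMod p) (ZMod p) ℝ :=
  Matrix.of fun k a => θ (r k) (a - s k)

/-- Any shifts of `p` distinct vectors of `θ` are linearly independent, and remain so when one of
them is replaced by the all-ones vector. -/
def ShiftGeneric (θ : Q → ZMod p → ℝ) : Prop :=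
  ∀ r : ZMod p → Q, Function.Injective r → ∀ s : ZMod p → ZMod p,
    (shiftedRows θ r s).det ≠ 0 ∧ ∀ k, ((shiftedRows θ r s).updateRow k 1).det ≠ 0

lemma shiftedRows_update (θ : Q → ZMod p → ℝ) (r : ZMod p → Q) (s : ZMod p → ZMod p)
    (k : ZMod p) (q : Q) (t : ZMod p) :
    shiftedRows θ (Function.update r k q) (Function.update s k t) =
      (shiftedRows θ r s).updateRow k (fun a => θ q (a - t)) := by
  ext i a
  by_cases hi : i = k
  · subst hi; simp [shiftedRows]
  · simp [shiftedRows, hi, Matrix.updateRow_ne]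

lemma sum_shift (v : ZMod p → ℝ) (t : ZMod p) : ∑ a, v (a - t) = ∑ a, v a :=
  Equiv.sum_comp (Equiv.subRight t) v

lemma injective_update_of_notMem {α β : Type*} [DecidableEq α] {r : α → β}
    (hr : Function.Injective r) {k : α} {q : β} (hq : ∀ i, r i ≠ q) :
    Function.Injective (Function.update r k q) := by
  intro i j hij
  by_cases hi : i = k <;> by_cases hj : j = k
  · rw [hi, hj]
  · subst hi
    rw [Function.update_self, Function.update_of_ne hj] at hij
    exact absurd hij.symm (hq j)
  · subst hj
    rw [Function.update_self, Function.update_of_ne hi] at hij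
    exact absurd hij (hq i)
  · rw [Function.update_of_ne hi, Function.update_of_ne hj] at hij
    exact hr hij

lemma ShiftGeneric.coneSign_eq_sum {θ : Q → ZMod p → ℝ} (hθ : ShiftGeneric θ)
    (hpos : ∀ q, 0 < ∑ a, θ q a) {r : ZMod p → Q} (hr : Function.Injective r)
    (s : ZMod p → ZMod p) {q : Q} (hq : ∀ i, r i ≠ q) (t : ZMod p) :
    coneSign (shiftedRows θ r s) =
      ∑ k, coneSign ((shiftedRows θ r s).updateRow k (fun a => θ q (a - t))) := by
  refine coneSign_eq_sum_updateRow _ _ (hθ r hr s).1 (hθ r hr s).2 (fun k => ?_) (fun k l => ?_)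
    (fun k => ?_) ?_
  · rw [← shiftedRows_update]
    exact (hθ _ (injective_update_of_notMem hr hq) _).1
  · rw [← shiftedRows_update]
    exact (hθ _ (injective_update_of_notMem hr hq) _).2 l
  · exact (sum_shift (θ (r k)) (s k)).symm ▸ hpos _
  · exact (sum_shift (θ q) t).symm ▸ hpos _

/-- The sum of a translation-invariant function of permutations is `p` times the sum over the
permutations fixing `0`. -/
lemma sum_perm_eq_mul (f : Equiv.Perm (ZMod p) → ℤ)
    (hf : ∀ σ a, f (σ * Equiv.addRight a) = f σ) :
    ∑ σ, f σ = p * ∑ σ : Equiv.Perm (ZMod p), if σ 0 = 0 then f σ else 0 := by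
  have h1 : ∀ a : ZMod p, (∑ σ : Equiv.Perm (ZMod p), if σ a = 0 then f σ else 0) =
      ∑ σ : Equiv.Perm (ZMod p), if σ 0 = 0 then f σ else 0 := by
    intro a
    rw [← Equiv.sum_comp (Equiv.mulRight (Equiv.addRight a : Equiv.Perm (ZMod p)))
      (fun σ => if σ 0 = 0 then f σ else 0)]
    simp [hf]
  have h2 : ∀ σ : Equiv.Perm (ZMod p), f σ = ∑ a, if σ a = 0 then f σ else 0 := by
    intro σ
    rw [Finset.sum_eq_single (σ.symm 0)]
    · simp
    · intro a _ ha
      rw [if_neg]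
      intro h
      exact ha (by simp [← h])
    · simp
  rw [Finset.sum_congr rfl fun σ _ => h2 σ, Finset.sum_comm, Finset.sum_congr rfl fun a _ => h1 a]
  simp [ZMod.card]

/-- The signed count of the cones spanned by the vectors `θ (c j)`, arranged along a permutation `σ`
and shifted to their positions, except that `θ (c 0)` is not shifted. -/
noncomputable def rookDegree (θ : Q → ZMod p → ℝ) (c : ZMod p → Q) : ℤ :=
  ∑ σ : Equiv.Perm (ZMod p),
    coneSign (shiftedRows θ (fun i => c (σ i)) (fun i => if σ i = 0 then 0 else i))

lemma rookDegree_update_modEq {θ : Q → ZMod p → ℝ} (hθ : ShiftGeneric θ)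
    (hpos : ∀ q, 0 < ∑ a, θ q a) {c : ZMod p → Q} (hc : Function.Injective c)
    {j₀ : ZMod p} (hj₀ : j₀ ≠ 0) {q : Q} (hq : ∀ i, c i ≠ q) :
    rookDegree θ c ≡ rookDegree θ (Function.update c j₀ q) [ZMOD p] := by
  set g : ZMod p → Equiv.Perm (ZMod p) → ℤ := fun j σ => coneSign
    ((shiftedRows θ (fun i => c (σ i)) (fun i => if σ i = 0 then 0 else i)).updateRow (σ.symm j)
      (fun a => θ q (a - σ.symm j₀))) with hg
  have hsum : rookDegree θ c = ∑ j, ∑ σ, g j σ := by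
    rw [Finset.sum_comm]
    refine Finset.sum_congr rfl fun σ _ => ?_
    rw [hθ.coneSign_eq_sum hpos (r := fun i => c (σ i)) (hc.comp σ.injective) _
        (fun i => hq (σ i)) (σ.symm j₀),
      ← Equiv.sum_comp σ.symm]
  have hj : ∑ σ, g j₀ σ = rookDegree θ (Function.update c j₀ q) := by
    refine Finset.sum_congr rfl fun σ _ => ?_
    simp only [hg]
    rw [← shiftedRows_update]
    congr 2 with i
    · by_cases hi : i = σ.symm j₀
      · subst hi; simp
      · rw [Function.update_of_ne hi, Function.update_of_ne]
        rintro rfl; simp at hi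
    · by_cases hi : i = σ.symm j₀
      · subst hi; simp [hj₀]
      · rw [Function.update_of_ne hi]
  have hother : ∀ j, j ≠ 0 → j ≠ j₀ → ∑ σ, g j σ = 0 := by
    intro j hj0 hjj
    have h1 : ∀ σ, g j (Equiv.swap 0 j * σ) = - g j σ := by
      intro σ
      simp only [hg]
      rw [← coneSign_swap _ (a := σ.symm 0) (b := σ.symm j) (by simpa using hj0.symm)]
      congr 1
      have e1 : (Equiv.swap 0 j * σ).symm j = σ.symm 0 := by
        rw [Equiv.symm_apply_eq]; simp
      have e2 : (Equiv.swap 0 j * σ).symm j₀ = σ.symm j₀ := by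
        rw [Equiv.symm_apply_eq]; simp [Equiv.swap_apply_of_ne_of_ne hj₀ hjj.symm]
      rw [e1, e2]
      ext i a
      rw [Matrix.submatrix_apply]
      by_cases hi0 : i = σ.symm 0
      · subst hi0
        simp
      by_cases hij : i = σ.symm j
      · subst hij
        rw [Matrix.updateRow_ne hi0, Equiv.swap_apply_right, Matrix.updateRow_ne (Ne.symm hi0)]
        simp [shiftedRows]
      · have h0 : σ i ≠ 0 := fun h => hi0 (by simp [← h])
        have hj : σ i ≠ j := fun h => hij (by simp [← h])
        rw [Equiv.swap_apply_of_ne_of_ne hi0 hij, Matrix.updateRow_ne hi0, Matrix.updateRow_ne hij]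
        simp [shiftedRows, Equiv.swap_apply_of_ne_of_ne h0 hj]
    have h2 := Equiv.sum_comp (Equiv.mulLeft (Equiv.swap 0 j)) (g j)
    simp only [Equiv.coe_mulLeft, h1, Finset.sum_neg_distrib] at h2
    linarith
  have hzero : (p : ℤ) ∣ ∑ σ, g 0 σ := by
    rw [sum_perm_eq_mul]
    · exact Dvd.intro _ rfl
    · intro σ b
      simp only [hg]
      refine Eq.trans ?_ (coneSign_submatrix _ (Equiv.addRight b))
      congr 1
      have e : ∀ j, (σ * Equiv.addRight b).symm j = σ.symm j - b := by
        intro j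
        rw [Equiv.symm_apply_eq]; simp
      ext i a
      rw [e, e, Matrix.submatrix_apply]
      by_cases hi : i = σ.symm 0 - b
      · subst hi
        rw [Matrix.updateRow_self]
        simp only [Equiv.coe_addRight, sub_add_cancel, Matrix.updateRow_self]
        congr 1
        ring
      · have hi' : i + b ≠ σ.symm 0 := fun h => hi (by rw [← h]; ring)
        have hi'' : σ (i + b) ≠ 0 := fun h => hi' (by rw [← h]; simp)
        rw [Matrix.updateRow_ne hi, Equiv.coe_addRight, Matrix.updateRow_ne hi']
        simp [shiftedRows, hi'']
  rw [hsum, ← Finset.add_sum_erase _ _ (Finset.mem_univ (0 : ZMod p)),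
    ← Finset.add_sum_erase _ _ (Finset.mem_erase.2 ⟨hj₀, Finset.mem_univ _⟩), hj,
    Finset.sum_eq_zero (fun j hj => hother j (by simp at hj; exact hj.2) (by simp at hj; exact hj.1)),
    add_zero]
  exact (Int.modEq_iff_dvd.2 (by simpa using hzero.neg_right))

lemma rookDegree_modEq {θ : Q → ZMod p → ℝ} (hθ : ShiftGeneric θ)
    (hpos : ∀ q, 0 < ∑ a, θ q a) {c c' : ZMod p → Q} (hc : Function.Injective c)
    (hc' : Function.Injective c') (h0 : c 0 = c' 0) (hcc : ∀ i j, j ≠ 0 → c i ≠ c' j) :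
    rookDegree θ c ≡ rookDegree θ c' [ZMOD p] := by
  classical
  have key : ∀ S : Finset (ZMod p), 0 ∉ S →
      Function.Injective (S.piecewise c' c) ∧
        rookDegree θ c ≡ rookDegree θ (S.piecewise c' c) [ZMOD p] := by
    intro S
    induction S using Finset.induction_on with
    | empty => exact fun _ => ⟨by simpa using hc, by simp⟩
    | insert j S hj ih =>
      intro h
      simp only [Finset.mem_insert, not_or] at h
      obtain ⟨hinj, hmod⟩ := ih h.2
      have hq : ∀ i, S.piecewise c' c i ≠ c' j := by
        intro i
        by_cases hi : i ∈ S
        · rw [Finset.piecewise_eq_of_mem _ _ _ hi]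
          exact fun h' => hj (hc' h' ▸ hi)
        · rw [Finset.piecewise_eq_of_notMem _ _ _ hi]
          exact hcc i j (Ne.symm h.1)
      rw [Finset.piecewise_insert]
      exact ⟨injective_update_of_notMem hinj hq,
        hmod.trans (rookDegree_update_modEq hθ hpos hinj (Ne.symm h.1) hq)⟩
  have h := (key (Finset.univ.erase 0) (by simp)).2
  convert h using 2
  ext1 i
  by_cases hi : i = 0
  · subst hi; simp [h0]
  · simp [hi]

/-- If the signed count is nonzero, then the all-ones vector lies in a cone spanned by vectors
`θ (y i)` for `i` in a nonempty set `I` and vectors `θ (c j)` with distinct `j ≠ 0` at the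
positions outside `I`. -/
lemma exists_coneSign_ne_zero {θ : Q → ZMod p → ℝ} (hθ : ShiftGeneric θ)
    (hpos : ∀ q, 0 < ∑ a, θ q a) {c y : ZMod p → Q} (hc : Function.Injective c)
    (hy : Function.Injective y) (hcy : ∀ i j, c i ≠ y j) (h : rookDegree θ c ≠ 0) :
    ∃ (I : Finset (ZMod p)) (σ : Equiv.Perm (ZMod p)), σ.symm 0 ∈ I ∧
      coneSign (shiftedRows θ (I.piecewise y (c ∘ σ)) id) ≠ 0 := by
  classical
  by_contra! hno
  apply h
  set H : Finset (ZMod p) → ZMod p → ℤ := fun I k => ∑ σ : Equiv.Perm (ZMod p),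
    if σ k = 0 then coneSign ((shiftedRows θ (I.piecewise y (c ∘ σ)) id).updateRow k (θ (c 0)))
    else 0 with hH
  have hI : ∀ I : Finset (ZMod p), I.Nonempty → ∑ k, H I k = 0 := by
    rintro I ⟨i₀, hi₀⟩
    have h1 : ∀ k, H I k = ∑ σ : Equiv.Perm (ZMod p), if σ i₀ = 0 then
        coneSign ((shiftedRows θ (I.piecewise y (c ∘ σ)) id).updateRow k (θ (c 0))) else 0 := by
      intro k
      simp only [hH]
      rw [← Equiv.sum_comp (Equiv.mulRight (Equiv.swap i₀ k))]
      refine Finset.sum_congr rfl fun σ _ => ?_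
      simp only [Equiv.coe_mulRight, Equiv.Perm.mul_apply, Equiv.swap_apply_right]
      congr 2
      ext i a
      by_cases hi : i = k
      · subst hi; simp
      rw [Matrix.updateRow_ne hi, Matrix.updateRow_ne hi]
      by_cases hiI : i ∈ I
      · simp [shiftedRows, hiI]
      · have : i ≠ i₀ := fun h => hiI (h ▸ hi₀)
        simp [shiftedRows, hiI, Equiv.swap_apply_of_ne_of_ne this hi]
    rw [Finset.sum_congr rfl fun k _ => h1 k, Finset.sum_comm]
    refine Finset.sum_eq_zero fun σ _ => ?_
    by_cases hσ : σ i₀ = 0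
    · simp only [if_pos hσ]
      have hσ' : σ.symm 0 = i₀ := by simp [← hσ]
      rw [← hno I σ (hσ' ▸ hi₀), hθ.coneSign_eq_sum hpos (q := c 0) (t := 0)]
      · simp
      · intro i j hij
        by_cases hi : i ∈ I <;> by_cases hj : j ∈ I <;>
          simp only [hi, hj, Finset.piecewise_eq_of_mem, Finset.piecewise_eq_of_notMem,
            not_false_eq_true, Function.comp_apply] at hij
        · exact hy hij
        · exact absurd hij.symm (hcy _ _)
        · exact absurd hij (hcy _ _)
        · exact σ.injective (hc hij)
      · intro i
        by_cases hi : i ∈ I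
        · rw [Finset.piecewise_eq_of_mem _ _ _ hi]
          exact (hcy _ _).symm
        · rw [Finset.piecewise_eq_of_notMem _ _ _ hi]
          intro h'
          have : σ i = 0 := hc h'
          exact hi (by rw [← this] at hσ; rwa [← σ.injective hσ])
    · simp [hσ]
  have hdeg : rookDegree θ c = ∑ k, H ∅ k := by
    simp only [hH]
    rw [Finset.sum_comm]
    refine Finset.sum_congr rfl fun σ _ => ?_
    rw [Finset.sum_eq_single (σ.symm 0)]
    · rw [if_pos (by simp)]
      congr 1
      ext i a
      by_cases hi : i = σ.symm 0
      · subst hi; simp [shiftedRows]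
      · have : σ i ≠ 0 := fun h => hi (by simp [← h])
        rw [Matrix.updateRow_ne hi]
        simp [shiftedRows, this]
    · intro k _ hk
      rw [if_neg]
      exact fun h => hk (by simp [← h])
    · simp
  have hinv : ∀ k, ∑ I : Finset (ZMod p), (-1) ^ I.card * H I k = 0 := by
    intro k
    refine Finset.sum_involution (fun I _ => symmDiff I {k}) ?_ ?_ ?_ ?_
    · intro I _
      have hHk : H (symmDiff I {k}) k = H I k := by
        simp only [hH]
        refine Finset.sum_congr rfl fun σ _ => ?_
        congr 2
        ext i a
        by_cases hi : i = k
        · subst hi; simp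
        · rw [Matrix.updateRow_ne hi, Matrix.updateRow_ne hi]
          simp [shiftedRows, Finset.piecewise, Finset.mem_symmDiff, hi]
      rw [hHk]
      by_cases hk : k ∈ I
      · have : symmDiff I {k} = I.erase k := by
          ext i; by_cases hi : i = k <;> simp [Finset.mem_symmDiff, hi, hk]
        rw [this, ← Finset.card_erase_add_one hk]
        ring
      · have : symmDiff I {k} = insert k I := by
          ext i; by_cases hi : i = k <;> simp [Finset.mem_symmDiff, hi, hk]
        rw [this, Finset.card_insert_of_notMem hk]
        ring
    · intro I _ _ heq
      have : k ∈ symmDiff I {k} ↔ k ∈ I := by rw [heq]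
      simp [Finset.mem_symmDiff] at this
    · intro I _; exact Finset.mem_univ _
    · intro I _; exact symmDiff_symmDiff_cancel_right _ _
  have htot : ∑ I : Finset (ZMod p), (-1) ^ I.card * ∑ k, H I k = 0 := by
    simp only [Finset.mul_sum]
    rw [Finset.sum_comm]
    exact Finset.sum_eq_zero fun k _ => hinv k
  rw [Finset.sum_eq_single ∅] at htot
  · rw [hdeg]; simpa using htot
  · intro I _ hne
    rw [hI I (Finset.nonempty_iff_ne_empty.2 hne), mul_zero]
  · simp

end ShiftedRows

section Perturbation

open Filter Topology

lemma det_updateRow_one {n : Type*} [Fintype n] [DecidableEq n] (k : n) (v : n → ℝ) :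
    ((1 : Matrix n n ℝ).updateRow k v).det = v k := by
  rw [← Matrix.cramer_transpose_apply, Matrix.transpose_one, Matrix.cramer_one]
  rfl

lemma dense_det_ne_zero {n E : Type*} [Fintype n] [DecidableEq n] [AddCommGroup E] [Module ℝ E]
    [TopologicalSpace E] [ContinuousAdd E] [ContinuousSMul ℝ E] (M : E → Matrix n n ℝ)
    (hM : ∀ x y (t : ℝ), M (x + t • (y - x)) = M x + t • (M y - M x))
    {y : E} (hy : (M y).det ≠ 0) : Dense {x | (M x).det ≠ 0} := by
  intro x
  set q : Polynomial ℝ :=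
    (Matrix.of fun i j => Polynomial.C (M x i j) +
      Polynomial.X * Polynomial.C (M y i j - M x i j)).det with hq
  have heval : ∀ t, q.eval t = (M (x + t • (y - x))).det := by
    intro t
    rw [hq, hM, ← Polynomial.coe_evalRingHom, RingHom.map_det]
    congr 1
    ext i j
    simp
  have hq0 : q ≠ 0 := by
    intro h
    apply hy
    have := heval 1
    rw [h] at this
    simpa using this.symm
  have hev : ∀ᶠ t in 𝓝[≠] (0 : ℝ), q.eval t ≠ 0 := by
    exact nhdsNE_le_cofinite _ (Polynomial.finite_setOfPred_isRoot hq0).compl_mem_cofinite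
  have hlim : Tendsto (fun t : ℝ => x + t • (y - x)) (𝓝[≠] 0) (𝓝 x) := by
    have h : Continuous fun t : ℝ => x + t • (y - x) := by fun_prop
    have := h.tendsto 0
    simp only [zero_smul, add_zero] at this
    exact this.mono_left nhdsWithin_le_nhds
  refine mem_closure_of_tendsto hlim (hev.mono fun t ht => ?_)
  rw [heval] at ht
  exact ht

variable {p : ℕ} [Fact p.Prime] {Q : Type*}

lemma continuous_shiftedRows (r : ZMod p → Q) (s : ZMod p → ZMod p) :
    Continuous fun θ : Q → ZMod p → ℝ => shiftedRows θ r s := by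
  unfold shiftedRows
  refine continuous_matrix fun i j => ?_
  simp only [Matrix.of_apply]
  fun_prop

lemma dense_shiftGeneric [Finite Q] :
    Dense {θ : Q → ZMod p → ℝ | ShiftGeneric θ} := by
  classical
  have h : {θ : Q → ZMod p → ℝ | ShiftGeneric θ} =
      ⋂ (rs : {r : ZMod p → Q // Function.Injective r} × (ZMod p → ZMod p)),
        ⋂ (k : Option (ZMod p)), {θ | (k.elim (shiftedRows θ rs.1 rs.2)
          fun k => (shiftedRows θ rs.1 rs.2).updateRow k 1).det ≠ 0} := by
    ext θ
    simp [ShiftGeneric, Option.forall]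
  rw [h]
  have hcont : ∀ (r : ZMod p → Q) (s : ZMod p → ZMod p) (k : Option (ZMod p)),
      Continuous fun θ : Q → ZMod p → ℝ =>
        k.elim (shiftedRows θ r s) fun k => (shiftedRows θ r s).updateRow k 1 := by
    intro r s k
    cases k with
    | none => exact continuous_shiftedRows r s
    | some k => exact (continuous_shiftedRows r s).matrix_updateRow k continuous_const
  have hopen : ∀ (r : ZMod p → Q) (s : ZMod p → ZMod p) (k : Option (ZMod p)),
      IsOpen {θ : Q → ZMod p → ℝ | (k.elim (shiftedRows θ r s)
          fun k => (shiftedRows θ r s).updateRow k 1).det ≠ 0} := fun r s k =>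
    isOpen_ne_fun (hcont r s k).matrix_det continuous_const
  have : Finite {r : ZMod p → Q // Function.Injective r} := Subtype.finite
  refine dense_iInter_of_isOpen (fun rs => isOpen_iInter_of_finite fun k => hopen _ _ k) ?_
  rintro ⟨⟨r, hr⟩, s⟩
  refine dense_iInter_of_isOpen (fun k => hopen _ _ k) fun k => ?_
  have hone : shiftedRows (fun q a => if r (a + s (Function.invFun r q)) = q then (1 : ℝ) else 0) r s
      = 1 := by
    ext i j
    simp [shiftedRows, Function.leftInverse_invFun hr i, Matrix.one_apply, hr.eq_iff, eq_comm]
  refine dense_det_ne_zero (y := fun q a => if r (a + s (Function.invFun r q)) = q then 1 else 0)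
    _ ?_ ?_
  · intro x y t
    cases k with
    | none => ext i j; simp [shiftedRows]
    | some k => ext i j; by_cases hi : i = k <;> simp [shiftedRows, Matrix.updateRow_apply, hi]
  · cases k with
    | none => simp [hone]
    | some k =>
      simp only [Option.elim_some, hone]
      rw [det_updateRow_one]
      exact one_ne_zero

lemma eventually_coneSign_eq_one {X ι : Type*} [Fintype ι] [DecidableEq ι] [TopologicalSpace X]
    {M : X → Matrix ι ι ℝ} (hM : Continuous M) {x : X} (hx : M x = 1) :
    ∀ᶠ y in 𝓝 x, coneSign (M y) = 1 := by
  have h0 : ∀ᶠ y in 𝓝 x, 0 < (M y).det :=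
    hM.matrix_det.continuousAt.eventually (lt_mem_nhds (by simp [hx]))
  have h1 : ∀ᶠ y in 𝓝 x, ∀ k, 0 < ((M y).updateRow k 1).det := by
    refine eventually_all.2 fun k => ?_
    refine (hM.matrix_updateRow k continuous_const).matrix_det.continuousAt.eventually
      (lt_mem_nhds ?_)
    simp [hx, det_updateRow_one]
  filter_upwards [h0, h1] with y hy0 hy1
  rw [coneSign, if_pos fun k => mul_pos hy0 (hy1 k), if_pos hy0]

lemma eventually_coneSign_eq_zero {X ι : Type*} [Fintype ι] [DecidableEq ι] [TopologicalSpace X]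
    {M : X → Matrix ι ι ℝ} (hM : Continuous M) {x : X} (hx : ∀ k, 0 < ∑ i, M x k i) {j : ι}
    (hj : ∀ k, M x k j = 0) : ∀ᶠ y in 𝓝 x, coneSign (M y) = 0 := by
  have h : ∀ᶠ y in 𝓝 x, ∀ k, 0 < ∑ i, M y k i - (Fintype.card ι + 1) * M y k j := by
    refine eventually_all.2 fun k => ?_
    have hc : Continuous fun y => ∑ i, M y k i - (Fintype.card ι + 1) * M y k j := by
      have : ∀ i, Continuous fun y => M y k i := fun i => hM.matrix_elem k i
      fun_prop
    exact hc.continuousAt.eventually (lt_mem_nhds (by simpa [hj] using hx k))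
  filter_upwards [h] with y hy
  by_contra hne
  obtain ⟨a, ha, hsum⟩ := exists_of_coneSign_ne_zero hne
  have hi : ∀ i, ∑ k, a k * M y k i = 1 := fun i => by simpa using congrFun hsum i
  have h1 : ∑ k, a k * (∑ i, M y k i - (Fintype.card ι + 1) * M y k j) = -1 := by
    have e : ∀ k, a k * (∑ i, M y k i - (Fintype.card ι + 1) * M y k j) =
        ∑ i, a k * M y k i - (Fintype.card ι + 1) * (a k * M y k j) := fun k => by
      rw [mul_sub, Finset.mul_sum]; ring
    simp only [e]
    rw [Finset.sum_sub_distrib, Finset.sum_comm, ← Finset.mul_sum, hi j,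
      Finset.sum_congr rfl fun i _ => hi i]
    simp
  have h2 : 0 ≤ ∑ k, a k * (∑ i, M y k i - (Fintype.card ι + 1) * M y k j) :=
    Finset.sum_nonneg fun k _ => (mul_pos (ha k) (hy k)).le
  linarith

lemma isClosed_setOf_exists_cone_coeff {X ι : Type*} [Fintype ι] [TopologicalSpace X]
    {M : X → Matrix ι ι ℝ} (hM : Continuous M) (B : ι → ℝ) :
    IsClosed {x | ∃ a ∈ Set.Icc 0 B, ∀ v, ∑ k, a k * M x k v = 1} := by
  have hK : IsClosed {z : Set.Icc 0 B × X | ∀ v, ∑ k, z.1.1 k * M z.2 k v = 1} := by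
    simp only [Set.ofPred_forall]
    refine isClosed_iInter fun v => isClosed_eq ?_ continuous_const
    refine continuous_finsetSum _ fun k _ => Continuous.mul ?_ ?_
    · exact (continuous_apply k).comp (continuous_subtype_val.comp continuous_fst)
    · exact (hM.matrix_elem k v).comp continuous_snd
  convert isClosedMap_snd_of_compactSpace _ hK using 1
  ext x
  simp

lemma not_dvd_card_perm_fixing_zero :
    ¬ (p : ℤ) ∣ ∑ σ : Equiv.Perm (ZMod p), if σ 0 = 0 then 1 else 0 := by
  have hp : p.Prime := Fact.out
  have h := sum_perm_eq_mul (p := p) (fun _ => 1) fun _ _ => rfl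
  intro hd
  obtain ⟨k, hk⟩ := hd
  rw [hk] at h
  simp only [Finset.sum_const, Finset.card_univ, Fintype.card_perm, ZMod.card, nsmul_eq_mul,
    mul_one] at h
  have hfac : (p.factorial : ℤ) = p * ((p - 1).factorial : ℤ) := by
    exact_mod_cast (Nat.mul_factorial_pred hp.ne_zero).symm
  rw [hfac] at h
  have h' := mul_left_cancel₀ (by exact_mod_cast hp.ne_zero) h
  have : p ∣ (p - 1).factorial := by
    have : (p : ℤ) ∣ ((p - 1).factorial : ℤ) := Dvd.intro _ h'.symm
    exact_mod_cast this
  have := (hp.dvd_factorial).1 this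
  have := hp.pos
  omega

end Perturbation

open Filter Topology in
/-- Given nonnegative combinations indexed by `x j` for `j ≠ 0` and by `y i`, the all-ones vector is
a nonnegative combination of shifts of the `y i` at a nonempty set `I` of positions and of shifts of
distinct `x j` at the other positions. -/
lemma exists_shift_cone {p : ℕ} [Fact p.Prime] (x y : ZMod p → ZMod p → ℝ)
    (hx : ∀ j, 0 < ∑ a, x j a) (hy : ∀ i, 0 < ∑ a, y i a) :
    ∃ (I : Finset (ZMod p)) (σ : Equiv.Perm (ZMod p)), σ.symm 0 ∈ I ∧
      ∃ a : ZMod p → ℝ, (∀ k, 0 ≤ a k) ∧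
        ∀ v, ∑ k, a k * (I.piecewise y (x ∘ σ)) k (v - k) = 1 := by
  classical
  set θ₀ : Fin 3 × ZMod p → ZMod p → ℝ := fun q =>
    if q = (0, 0) ∨ q.1 = 1 then Pi.single 0 1 else if q.1 = 0 then x q.2 else y q.2 with hθ₀
  have hsum₀ : ∀ q, 0 < ∑ a, θ₀ q a := by
    intro q
    simp only [hθ₀]
    split_ifs
    · simp
    · exact hx _
    · exact hy _
  set c : ZMod p → Fin 3 × ZMod p := fun j => (0, j) with hc
  set c' : ZMod p → Fin 3 × ZMod p := fun j => if j = 0 then (0, 0) else (1, j) with hc'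
  set z : ZMod p → Fin 3 × ZMod p := fun i => (2, i) with hz
  have hθc' : ∀ j, θ₀ (c' j) = Pi.single 0 1 := by
    intro j
    by_cases hj : j = 0 <;> simp [hθ₀, hc', hj]
  obtain ⟨B, hB⟩ : ∃ B : ℝ, ∀ᶠ θ in 𝓝 θ₀, ∀ q, (p : ℝ) < B * ∑ a, θ q a := by
    obtain ⟨B, hB⟩ : ∃ B : ℝ, ∀ q, (p : ℝ) < B * ∑ a, θ₀ q a := by
      have : ∀ᶠ B : ℝ in atTop, ∀ q, (p : ℝ) < B * ∑ a, θ₀ q a :=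
        eventually_all.2 fun q => (tendsto_id.atTop_mul_const (hsum₀ q)).eventually_gt_atTop _
      exact this.exists
    refine ⟨B, eventually_all.2 fun q => ?_⟩
    have hcont : Continuous fun θ : Fin 3 × ZMod p → ZMod p → ℝ => B * ∑ a, θ q a := by fun_prop
    exact hcont.continuousAt.eventually (lt_mem_nhds (hB q))
  have hpos : ∀ᶠ θ in 𝓝 θ₀, ∀ q, 0 < ∑ a, θ q a := by
    refine eventually_all.2 fun q => ?_
    have hcont : Continuous fun θ : Fin 3 × ZMod p → ZMod p → ℝ => ∑ a, θ q a := by fun_prop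
    exact hcont.continuousAt.eventually (lt_mem_nhds (hsum₀ q))
  have hdeg : ∀ᶠ θ in 𝓝 θ₀, rookDegree θ c' =
      ∑ σ : Equiv.Perm (ZMod p), if σ 0 = 0 then 1 else 0 := by
    have : ∀ᶠ θ in 𝓝 θ₀, ∀ σ : Equiv.Perm (ZMod p), coneSign (shiftedRows θ (fun i => c' (σ i))
        (fun i => if σ i = 0 then 0 else i)) = if σ 0 = 0 then 1 else 0 := by
      refine eventually_all.2 fun σ => ?_
      by_cases hσ : σ 0 = 0
      · simp only [hσ, if_true]
        refine eventually_coneSign_eq_one (continuous_shiftedRows _ _) ?_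
        ext i j
        simp only [shiftedRows, Matrix.of_apply, hθc']
        by_cases hi : σ i = 0
        · have : i = 0 := σ.injective (hi.trans hσ.symm)
          subst this
          simp [hσ, Matrix.one_apply, Pi.single_apply, eq_comm]
        · simp [hi, Matrix.one_apply, Pi.single_apply, sub_eq_zero, eq_comm]
      · simp only [hσ, if_false]
        refine eventually_coneSign_eq_zero (continuous_shiftedRows _ _) (fun k => ?_)
          (j := σ.symm 0) fun k => ?_
        · exact (sum_shift (θ₀ (c' (σ k))) _).symm ▸ hsum₀ _
        · simp only [shiftedRows, Matrix.of_apply, hθc']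
          have h0 : σ.symm 0 ≠ 0 := fun h => hσ (by rw [Equiv.symm_apply_eq] at h; exact h.symm)
          by_cases hk : σ k = 0
          · simp [hk, h0]
          · have : σ.symm 0 ≠ k := fun h => hk (by simp [← h])
            simp [hk, sub_eq_zero, this]
    filter_upwards [this] with θ hθ
    exact Finset.sum_congr rfl fun σ _ => hθ σ
  set Z : Set (Fin 3 × ZMod p → ZMod p → ℝ) :=
    ⋃ P : {P : Finset (ZMod p) × Equiv.Perm (ZMod p) // P.2.symm 0 ∈ P.1},
      {θ | ∃ a ∈ Set.Icc (0 : ZMod p → ℝ) (fun _ => B), ∀ v, ∑ k, a k *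
        shiftedRows θ (P.1.1.piecewise z (c ∘ P.1.2)) id k v = 1} with hZ
  have hZclosed : IsClosed Z := isClosed_iUnion_of_finite fun P =>
    isClosed_setOf_exists_cone_coeff (continuous_shiftedRows _ _) _
  have hmem : θ₀ ∈ Z := by
    rw [← hZclosed.closure_eq, mem_closure_iff_frequently]
    have hgen := mem_closure_iff_frequently.1 (dense_shiftGeneric (Q := Fin 3 × ZMod p) θ₀)
    refine (hgen.and_eventually (hB.and (hpos.and hdeg))).mono ?_
    rintro θ ⟨hθ, hθB, hθpos, hθdeg⟩
    have hcinj : Function.Injective c := fun i j h => by simpa [hc] using h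
    have hc'inj : Function.Injective c' := by
      intro i j h
      by_cases hi : i = 0 <;> by_cases hj : j = 0 <;> simp_all
    have hzinj : Function.Injective z := fun i j h => by simpa [hz] using h
    have hmod := rookDegree_modEq hθ hθpos hcinj hc'inj (by simp [hc, hc'])
      (fun i j hj => by simp [hc, hc', hj])
    have hne : rookDegree θ c ≠ 0 := by
      intro h
      rw [h, hθdeg] at hmod
      exact not_dvd_card_perm_fixing_zero (p := p) (Int.modEq_zero_iff_dvd.1 hmod.symm)
    obtain ⟨I, σ, hI, hIσ⟩ := exists_coneSign_ne_zero hθ hθpos hcinj hzinj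
      (fun i j => by simp [hc, hz]) hne
    obtain ⟨a, ha, hsum⟩ := exists_of_coneSign_ne_zero hIσ
    have hv : ∀ v, ∑ k, a k * shiftedRows θ (I.piecewise z (c ∘ σ)) id k v = 1 :=
      fun v => by simpa using congrFun hsum v
    refine Set.mem_iUnion.2 ⟨⟨(I, σ), hI⟩, a, ⟨fun k => (ha k).le, fun k => ?_⟩, hv⟩
    have htot : ∑ k, a k * ∑ v, θ ((I.piecewise z (c ∘ σ)) k) v = p := by
      have : ∀ k, ∑ v, θ ((I.piecewise z (c ∘ σ)) k) v =
          ∑ v, shiftedRows θ (I.piecewise z (c ∘ σ)) id k v := fun k => (sum_shift _ _).symm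
      simp only [this, Finset.mul_sum]
      rw [Finset.sum_comm, Finset.sum_congr rfl fun v _ => hv v]
      simp [ZMod.card]
    have hle : a k * ∑ v, θ ((I.piecewise z (c ∘ σ)) k) v ≤ p := by
      rw [← htot]
      exact Finset.single_le_sum
        (f := fun k => a k * ∑ v, θ ((I.piecewise z (c ∘ σ)) k) v)
        (fun i _ => (mul_pos (ha i) (hθpos _)).le) (Finset.mem_univ k)
    exact (lt_of_mul_lt_mul_right (hle.trans_lt (hθB _)) (hθpos _).le).le
  obtain ⟨⟨⟨I, σ⟩, hI⟩, a, ⟨ha, -⟩, hv⟩ := Set.mem_iUnion.1 hmem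
  refine ⟨I, σ, hI, a, ha, fun v => ?_⟩
  rw [← hv v]
  refine Finset.sum_congr rfl fun k _ => ?_
  congr 1
  by_cases hk : k ∈ I
  · simp [shiftedRows, hθ₀, hz, hk]
  · have : σ k ≠ 0 := fun h => hk (by simpa [← h] using hI)
    simp [shiftedRows, hθ₀, hc, hk, this]

/-- Balanced families from shifts: for a prime `p` and nonempty subsets
`A_1, …, A_{2p-1}` of `ℤ/p`, there is an injection `π : ℤ/p → [2p-1]` such that
the shifted family `(A_{π(i)} + i)_{i ∈ ℤ/p}` admits a perfect fractional
matching. -/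
theorem balanced_shifts (p : ℕ) [Fact p.Prime] (A : Fin (2 * p - 1) → Finset (ZMod p))
    (hA : ∀ j, (A j).Nonempty) :
    ∃ π : ZMod p → Fin (2 * p - 1), Function.Injective π ∧
      ∃ w : ZMod p → ℝ, (∀ i, w i ∈ Set.Icc (0 : ℝ) 1) ∧
        ∀ v : ZMod p, ∑ i ∈ Finset.univ.filter (fun i : ZMod p => v - i ∈ A (π i)), w i = 1 := by
  have hp : 0 < p := (Fact.out : p.Prime).pos
  obtain ⟨g⟩ : Nonempty ({j : ZMod p // j ≠ 0} ⊕ ZMod p ↪ Fin (2 * p - 1)) := by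
    refine Function.Embedding.nonempty_of_card_le ?_
    rw [Fintype.card_sum, Fintype.card_subtype_compl, Fintype.card_fin, ZMod.card,
      Fintype.card_subtype_eq]
    omega
  set x : ZMod p → Fin (2 * p - 1) := fun j => if h : j ≠ 0 then g (.inl ⟨j, h⟩) else g (.inr 0)
    with hx
  set y : ZMod p → Fin (2 * p - 1) := fun i => g (.inr i) with hy
  have hpos : ∀ j, 0 < ∑ a, if a ∈ A j then (1 : ℝ) else 0 := by
    intro j
    simpa [Finset.card_pos] using hA j
  obtain ⟨I, σ, hI, w, hw, hv⟩ := exists_shift_cone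
    (fun j a => if a ∈ A (x j) then 1 else 0) (fun i a => if a ∈ A (y i) then 1 else 0)
    (fun j => hpos _) (fun i => hpos _)
  have hσ : ∀ k, k ∉ I → σ k ≠ 0 := fun k hk h => hk (by simpa [← h] using hI)
  set π := I.piecewise y (x ∘ σ) with hπ
  have hv' : ∀ v : ZMod p,
      ∑ i ∈ Finset.univ.filter (fun i : ZMod p => v - i ∈ A (π i)), w i = 1 := by
    intro v
    rw [← hv v, Finset.sum_filter]
    refine Finset.sum_congr rfl fun k _ => ?_
    by_cases hk : k ∈ I <;> simp [hπ, hk]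
  refine ⟨π, ?_, w, fun i => ⟨hw i, ?_⟩, hv'⟩
  · intro i j hij
    by_cases hi : i ∈ I <;> by_cases hj : j ∈ I
    · simpa [hπ, hi, hj, hy] using hij
    · simp [hπ, hi, hj, hy, hx, hσ j hj] at hij
    · simp [hπ, hi, hj, hy, hx, hσ i hi] at hij
    · simpa [hπ, hi, hj, hx, hσ i hi, hσ j hj] using hij
  · obtain ⟨b, hb⟩ := hA (π i)
    rw [← hv' (b + i)]
    exact Finset.single_le_sum (fun k _ => hw k) (by simpa using hb)
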